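/- Let r ∈ ℕ^m, c ∈ ℕ^n with equal coordinate sums. If c = (1,1,...,1) or c = (2,2,...,2) (or, symmetrically, if r = (1,1,...,1) or r = (2,2,...,2)), then the combinatorial Bruhat order ≤_B and the combinatorial secondary Bruhat order ≤_{secB} coincide on BCT(r,c): for all M1, M2 ∈ BCT(r,c), M1 ≤_B M2 if and only if M1 ≤_{secB} M2. -/

import Mathlib

open Finset

/-- `M` is a 0-1 matrix with row sum vector `r` and column sum vector `c`. -/
def isBCT {m n : ℕ} (r : Fin m → ℕ) (c : Fin n → ℕ) (M : Fin m → Fin n → ℕ) : Prop :=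
  (∀ i j, M i j = 0 ∨ M i j = 1) ∧ (∀ i, ∑ j, M i j = r i) ∧ (∀ j, ∑ i, M i j = c j)

/-- `M'` is obtained from `M` by a single `L2 → I2` interchange. -/
def InterchangeStep {m n : ℕ} (M M' : Fin m → Fin n → ℕ) : Prop :=
  ∃ (i j : Fin m) (k l : Fin n), i < j ∧ k < l ∧
    M i k = 0 ∧ M i l = 1 ∧ M j k = 1 ∧ M j l = 0 ∧
    M' i k = 1 ∧ M' i l = 0 ∧ M' j k = 0 ∧ M' j l = 1 ∧
    (∀ p q, ¬((p = i ∨ p = j) ∧ (q = k ∨ q = l)) → M' p q = M p q)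

/-- The combinatorial secondary Bruhat order: `M1 ≤ M2` iff `M1` is obtained from `M2`
by a (possibly empty) finite sequence of `L2 → I2` interchanges. -/
def secBLE {m n : ℕ} (M1 M2 : Fin m → Fin n → ℕ) : Prop :=
  Relation.ReflTransGen InterchangeStep M2 M1

/-- `σ(M)_{ij} = ∑_{k ≤ i} ∑_{l ≤ j} m_{kl}`. -/
def sigmaM {m n : ℕ} (M : Fin m → Fin n → ℕ) (i : Fin m) (j : Fin n) : ℕ :=
  ∑ k ∈ Finset.univ.filter (fun k : Fin m => k ≤ i),
    ∑ l ∈ Finset.univ.filter (fun l : Fin n => l ≤ j), M k l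

/-- The combinatorial Bruhat order: `M1 ≤_B M2` iff `σ(M1) ≥ σ(M2)` entrywise. -/
def bruhatLE {m n : ℕ} (M1 M2 : Fin m → Fin n → ℕ) : Prop :=
  ∀ i j, sigmaM M2 i j ≤ sigmaM M1 i j

/-- Sum of the entries of `X` in the first `i` rows and the first `j` columns. -/
def leadingSum (X : ℕ → ℕ → ℤ) (i j : ℕ) : ℤ :=
  ∑ p ∈ range i, ∑ q ∈ range j, X p q

lemma leadingSum_sub (X Y : ℕ → ℕ → ℤ) (i j : ℕ) :
    leadingSum (fun p q => X p q - Y p q) i j = leadingSum X i j - leadingSum Y i j := by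
  simp [leadingSum]

lemma leadingSum_sub_leadingSum {X : ℕ → ℕ → ℤ} {k : ℕ} (hX : ∀ q < k, ∀ p, X p q = 0)
    {i i' j : ℕ} (hi : i ≤ i') (hj : k ≤ j) :
    leadingSum X i' j - leadingSum X i j = ∑ t ∈ Ico k j, ∑ p ∈ Ico i i', X p t := by
  have hrow (p : ℕ) : ∑ q ∈ range j, X p q = ∑ q ∈ Ico k j, X p q := by
    rw [← sum_range_add_sum_Ico _ hj, sum_eq_zero fun q hq => hX q (mem_range.1 hq) p, zero_add]
  rw [sum_comm, leadingSum, leadingSum, ← sum_range_add_sum_Ico _ hi]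
  simp [hrow]

/-- If the leading sums of `X` are nonnegative and `X` vanishes left of column `k`, follow the
row band `[a, e)` rightwards from column `k` to the first column at which some leading sum in
the band fails to be positive. -/
lemma exists_first_nonpos {X : ℕ → ℕ → ℤ} {k n a e : ℕ} (hae : a < e)
    (hX : ∀ q < k, ∀ p, X p q = 0) (hT : ∀ i j, 0 ≤ leadingSum X i j)
    (hn : ∀ i j, n ≤ j → leadingSum X i j = 0) :
    ∃ s p, k ≤ s ∧ a ≤ p ∧ p < e ∧
      (∀ q t, a ≤ q → q < e → k ≤ t → t < s → 0 < leadingSum X (q + 1) (t + 1)) ∧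
      ∑ t ∈ Ico k (s + 1), ∑ q ∈ Ico a (p + 1), X q t ≤ 0 ∧
      0 ≤ ∑ t ∈ Ico k (s + 1), ∑ q ∈ Ico (p + 1) (e + 1), X q t := by
  classical
  have hex : ∃ s, k ≤ s ∧ ∃ p, a ≤ p ∧ p < e ∧ leadingSum X (p + 1) (s + 1) ≤ 0 :=
    ⟨k + n, by omega, a, le_rfl, hae, (hn _ _ (by omega)).le⟩
  obtain ⟨hks, p, hap, hpe, hp⟩ := Nat.find_spec hex
  refine ⟨Nat.find hex, p, hks, hap, hpe, fun q t haq hqe hkt hts => ?_, ?_, ?_⟩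
  · by_contra hneg
    exact Nat.find_min hex hts ⟨hkt, q, haq, hqe, not_lt.1 hneg⟩
  · rw [← leadingSum_sub_leadingSum hX (by omega) (by omega)]
    linarith [hT a (Nat.find hex + 1)]
  · rw [← leadingSum_sub_leadingSum hX (by omega) (by omega)]
    linarith [hT (e + 1) (Nat.find hex + 1)]

lemma not_three_of_sum_le_two {f : ℕ → ℤ} (h2 : ∀ s : Finset ℕ, ∑ p ∈ s, f p ≤ 2)
    {x y z : ℕ} (hxy : x < y) (hyz : y < z) (hx : f x = 1) (hy : f y = 1) (hz : f z = 1) :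
    False := by
  have h := h2 {x, y, z}
  rw [sum_insert (by simp; omega), sum_insert (by simp; omega), sum_singleton] at h
  omega

/-- If every nonzero entry with index in `s` forces the entry at `e ∈ s'` to be `1`, then the
sum over `s` is at most the sum over the disjoint set `s'`. -/
lemma sum_le_sum_of_forces {f : ℕ → ℤ} (h01 : ∀ p, f p = 0 ∨ f p = 1)
    (h2 : ∀ s : Finset ℕ, ∑ p ∈ s, f p ≤ 2) {s s' : Finset ℕ} {e : ℕ} (hes : e ∉ s)
    (hes' : e ∈ s') (h : ∀ p ∈ s, f p = 1 → f e = 1) :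
    ∑ p ∈ s, f p ≤ ∑ p ∈ s', f p := by
  have h0 (p : ℕ) : 0 ≤ f p := by rcases h01 p with h | h <;> omega
  have hle : f e ≤ ∑ p ∈ s', f p := single_le_sum (fun p _ => h0 p) hes'
  rcases h01 e with he | he
  · rw [sum_eq_zero fun p hp => (h01 p).resolve_right fun h1 => by have := h p hp h1; omega]
    exact sum_nonneg fun p _ => h0 p
  · have h' := h2 (insert e s)
    rw [sum_insert hes] at h'
    omega

section Core

variable {A C : ℕ → ℕ → ℤ} {m n : ℕ}

/-- The leading sums of `A` exceed those of `C` on the rows `[i, j)` and columns `[k, l)`. -/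
def ExceedsOn (A C : ℕ → ℕ → ℤ) (i j k l : ℕ) : Prop :=
  ∀ p q, i ≤ p → p < j → k ≤ q → q < l →
    leadingSum C (p + 1) (q + 1) < leadingSum A (p + 1) (q + 1)

lemma ExceedsOn.mono {i j k l i' j' l' : ℕ} (h : ExceedsOn A C i j k l)
    (hi : i ≤ i') (hj : j' ≤ j) (hl : l' ≤ l) : ExceedsOn A C i' j' k l' :=
  fun p q h₁ h₂ h₃ h₄ => h p q (by omega) (by omega) h₃ (by omega)

lemma exists_exceedsOn {k a e : ℕ} (hae : a < e) (hk : ∀ q < k, ∀ p, A p q = C p q)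
    (hT : ∀ i j, leadingSum C i j ≤ leadingSum A i j)
    (hn : ∀ i j, n ≤ j → leadingSum C i j = leadingSum A i j) :
    ∃ s p, k ≤ s ∧ a ≤ p ∧ p < e ∧ ExceedsOn A C a e k s ∧
      ∑ t ∈ Ico k (s + 1), ∑ q ∈ Ico a (p + 1), (A q t - C q t) ≤ 0 ∧
      0 ≤ ∑ t ∈ Ico k (s + 1), ∑ q ∈ Ico (p + 1) (e + 1), (A q t - C q t) := by
  obtain ⟨s, p, hks, hap, hpe, h, h₁, h₂⟩ :=
    exists_first_nonpos (X := fun p q => A p q - C p q) (n := n) hae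
      (fun q hq p => by simp [hk q hq p])
      (fun i j => by rw [leadingSum_sub]; linarith [hT i j])
      (fun i j hj => by rw [leadingSum_sub, hn i j hj, sub_self])
  refine ⟨s, p, hks, hap, hpe, fun q t haq hqe hkt hts => ?_, h₁, h₂⟩
  have := h q t haq hqe hkt hts
  rw [leadingSum_sub] at this
  linarith

/-- `C` contains an `L2` pattern that can be lowered to `I2` staying above `A`. -/
def CanLower (A C : ℕ → ℕ → ℤ) : Prop :=
  ∃ i j k l, i < j ∧ k < l ∧ ExceedsOn A C i j k l ∧
    C i k = 0 ∧ C i l = 1 ∧ C j k = 1 ∧ C j l = 0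

/-- `A` contains an `I2` pattern that can be raised to `L2` staying below `C`. -/
def CanRaise (A C : ℕ → ℕ → ℤ) : Prop :=
  ∃ i j k l, i < j ∧ k < l ∧ ExceedsOn A C i j k l ∧
    A i k = 1 ∧ A i l = 0 ∧ A j k = 0 ∧ A j l = 1

/-- The first differing column `k` has, in rows `[a, e]`, just an entry of `A` at `a` and just an
entry of `C` at `e`. -/
lemma canLower_or_canRaise_of_gap {k a e : ℕ}
    (hA01 : ∀ p q, A p q = 0 ∨ A p q = 1) (hC01 : ∀ p q, C p q = 0 ∨ C p q = 1)
    (hA2 : ∀ q, ∀ s : Finset ℕ, ∑ p ∈ s, A p q ≤ 2)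
    (hC2 : ∀ q, ∀ s : Finset ℕ, ∑ p ∈ s, C p q ≤ 2)
    (hT : ∀ i j, leadingSum C i j ≤ leadingSum A i j)
    (hn : ∀ i j, n ≤ j → leadingSum C i j = leadingSum A i j)
    (hk : ∀ q < k, ∀ p, A p q = C p q) (hae : a < e) (hAa : A a k = 1) (hCe : C e k = 1)
    (hA : ∀ p, a < p → p ≤ e → A p k = 0) (hC : ∀ p, a ≤ p → p < e → C p k = 0) :
    CanLower A C ∨ CanRaise A C := by
  by_contra! hno
  obtain ⟨hlow, hraise⟩ := hno
  obtain ⟨s, p, hks, hap, hpe, hex, h₁, h₂⟩ := exists_exceedsOn hae hk hT hn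
  have hCt (t : ℕ) (hkt : k < t) (hts : t ≤ s) (q : ℕ) (haq : a ≤ q) (hqe : q < e)
      (hq : C q t = 1) : C e t = 1 :=
    (hC01 e t).resolve_left fun h => hlow ⟨q, e, k, t, hqe, hkt,
      hex.mono haq le_rfl hts, hC q haq hqe, hq, hCe, h⟩
  have hAt (t : ℕ) (hkt : k < t) (hts : t ≤ s) (q : ℕ) (haq : a < q) (hqe : q ≤ e)
      (hq : A q t = 1) : A a t = 1 :=
    (hA01 a t).resolve_left fun h => hraise ⟨a, q, k, t, haq, hkt,
      hex.mono le_rfl hqe hts, hAa, h, hA q haq hqe, hq⟩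
  have hpos : 0 < ∑ t ∈ Ico k (s + 1), (∑ q ∈ Ico a (p + 1), (A q t - C q t) -
      ∑ q ∈ Ico (p + 1) (e + 1), (A q t - C q t)) := by
    have hC0 : ∑ q ∈ Ico a (p + 1), C q k = 0 :=
      sum_eq_zero fun q hq => by rw [mem_Ico] at hq; exact hC q (by omega) (by omega)
    have hA0 : ∑ q ∈ Ico (p + 1) (e + 1), A q k = 0 :=
      sum_eq_zero fun q hq => by rw [mem_Ico] at hq; exact hA q (by omega) (by omega)
    have hA1 : A a k ≤ ∑ q ∈ Ico a (p + 1), A q k :=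
      single_le_sum (f := (A · k)) (fun q _ => by rcases hA01 q k with h | h <;> omega)
        (by simp only [mem_Ico]; omega)
    have hC1 : C e k ≤ ∑ q ∈ Ico (p + 1) (e + 1), C q k :=
      single_le_sum (f := (C · k)) (fun q _ => by rcases hC01 q k with h | h <;> omega)
        (by simp only [mem_Ico]; omega)
    refine sum_pos' (fun t ht => ?_) ⟨k, mem_Ico.2 (by omega), ?_⟩
    · rw [mem_Ico] at ht
      simp only [sum_sub_distrib]
      rcases ht.1.eq_or_lt with rfl | hkt
      · omega
      · have hA' : ∑ q ∈ Ico (p + 1) (e + 1), A q t ≤ ∑ q ∈ Ico a (p + 1), A q t :=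
          sum_le_sum_of_forces (e := a) (fun q => hA01 q t) (hA2 t) (by simp; omega)
            (by simp; omega) fun q hq => by
              rw [mem_Ico] at hq
              exact hAt t hkt (by omega) q (by omega) (by omega)
        have hC' : ∑ q ∈ Ico a (p + 1), C q t ≤ ∑ q ∈ Ico (p + 1) (e + 1), C q t :=
          sum_le_sum_of_forces (e := e) (fun q => hC01 q t) (hC2 t) (by simp; omega)
            (by simp; omega) fun q hq => by
              rw [mem_Ico] at hq
              exact hCt t hkt (by omega) q (by omega) (by omega)
        omega
    · simp only [sum_sub_distrib]
      omega
  rw [sum_sub_distrib] at hpos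
  omega

/-- The first differing column `k` is `{a, b}` in `A` and `{e, d}` in `C` with
`a < b ≤ e < d`. -/
lemma canLower_or_canRaise_of_pairs {k a b e d : ℕ}
    (hA01 : ∀ p q, A p q = 0 ∨ A p q = 1) (hC01 : ∀ p q, C p q = 0 ∨ C p q = 1)
    (hA2 : ∀ q, ∀ s : Finset ℕ, ∑ p ∈ s, A p q ≤ 2)
    (hC2 : ∀ q, ∀ s : Finset ℕ, ∑ p ∈ s, C p q ≤ 2)
    (hT : ∀ i j, leadingSum C i j ≤ leadingSum A i j)
    (hn : ∀ i j, n ≤ j → leadingSum C i j = leadingSum A i j)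
    (hk : ∀ q < k, ∀ p, A p q = C p q) (hab : a < b) (hbe : b ≤ e) (hed : e < d)
    (hAa : A a k = 1) (hAb : A b k = 1) (hCe : C e k = 1) (hCd : C d k = 1) :
    CanLower A C ∨ CanRaise A C := by
  by_contra! hno
  obtain ⟨hlow, hraise⟩ := hno
  obtain ⟨s, p, hks, hap, hpd, hex, h₁, h₂⟩ :=
    exists_exceedsOn (show a < d by omega) hk hT hn
  have hC (q : ℕ) (hq : q < e) : C q k = 0 :=
    (hC01 q k).resolve_right fun h => not_three_of_sum_le_two (hC2 k) hq hed h hCe hCd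
  have hA (q : ℕ) (hq : b < q) : A q k = 0 :=
    (hA01 q k).resolve_right fun h => not_three_of_sum_le_two (hA2 k) hab hq hAa hAb h
  rcases lt_or_ge p e with hpe | hep
  · have hCt (t : ℕ) (hkt : k ≤ t) (hts : t ≤ s) (q : ℕ) (haq : a ≤ q) (hqp : q ≤ p) :
        C q t = 0 := by
      rcases hkt.eq_or_lt with rfl | hkt
      · exact hC q (by omega)
      refine (hC01 q t).resolve_right fun hq => ?_
      have he : C e t = 1 := (hC01 e t).resolve_left fun h =>
        hlow ⟨q, e, k, t, by omega, hkt, hex.mono haq hed.le hts, hC q (by omega), hq, hCe, h⟩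
      have hd : C d t = 1 := (hC01 d t).resolve_left fun h =>
        hlow ⟨q, d, k, t, by omega, hkt, hex.mono haq le_rfl hts, hC q (by omega), hq, hCd, h⟩
      exact not_three_of_sum_le_two (hC2 t) (by omega) hed hq he hd
    have hX (t : ℕ) (ht : t ∈ Ico k (s + 1)) (q : ℕ) (hq : q ∈ Ico a (p + 1)) :
        0 ≤ A q t - C q t := by
      rw [mem_Ico] at ht hq
      rw [hCt t (by omega) (by omega) q (by omega) (by omega)]
      rcases hA01 q t with h | h <;> omega
    have : 0 < ∑ t ∈ Ico k (s + 1), ∑ q ∈ Ico a (p + 1), (A q t - C q t) :=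
      sum_pos' (fun t ht => sum_nonneg (hX t ht)) ⟨k, mem_Ico.2 (by omega),
        sum_pos' (hX k (mem_Ico.2 (by omega))) ⟨a, mem_Ico.2 (by omega),
          by rw [hAa, hC a (by omega)]; norm_num⟩⟩
    omega
  · have hAt (t : ℕ) (hkt : k ≤ t) (hts : t ≤ s) (q : ℕ) (hpq : p < q) (hqd : q ≤ d) :
        A q t = 0 := by
      rcases hkt.eq_or_lt with rfl | hkt
      · exact hA q (by omega)
      refine (hA01 q t).resolve_right fun hq => ?_
      have ha : A a t = 1 := (hA01 a t).resolve_left fun h =>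
        hraise ⟨a, q, k, t, by omega, hkt, hex.mono le_rfl hqd hts, hAa, h, hA q (by omega), hq⟩
      have hb : A b t = 1 := (hA01 b t).resolve_left fun h =>
        hraise ⟨b, q, k, t, by omega, hkt, hex.mono hab.le hqd hts, hAb, h, hA q (by omega), hq⟩
      exact not_three_of_sum_le_two (hA2 t) hab (by omega) ha hb hq
    have hX (t : ℕ) (ht : t ∈ Ico k (s + 1)) (q : ℕ) (hq : q ∈ Ico (p + 1) (d + 1)) :
        A q t - C q t ≤ 0 := by
      rw [mem_Ico] at ht hq
      rw [hAt t (by omega) (by omega) q (by omega) (by omega)]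
      rcases hC01 q t with h | h <;> omega
    have : ∑ t ∈ Ico k (s + 1), ∑ q ∈ Ico (p + 1) (d + 1), (A q t - C q t) < 0 :=
      sum_neg' (fun t ht => sum_nonpos (hX t ht)) ⟨k, mem_Ico.2 (by omega),
        sum_neg' (hX k (mem_Ico.2 (by omega))) ⟨d, mem_Ico.2 (by omega),
          by rw [hCd, hA d (by omega)]; norm_num⟩⟩
    omega

lemma canLower_or_canRaise
    (hA01 : ∀ p q, A p q = 0 ∨ A p q = 1) (hC01 : ∀ p q, C p q = 0 ∨ C p q = 1)
    (hA2 : ∀ q, ∀ s : Finset ℕ, ∑ p ∈ s, A p q ≤ 2)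
    (hC2 : ∀ q, ∀ s : Finset ℕ, ∑ p ∈ s, C p q ≤ 2)
    (hcol : ∀ q, ∑ p ∈ range m, A p q = ∑ p ∈ range m, C p q)
    (hm : ∀ p q, m ≤ p → A p q = 0)
    (hT : ∀ i j, leadingSum C i j ≤ leadingSum A i j)
    (hn : ∀ i j, n ≤ j → leadingSum C i j = leadingSum A i j)
    (hne : ∃ q p, A p q ≠ C p q) :
    CanLower A C ∨ CanRaise A C := by
  classical
  obtain ⟨k, hdiff, hkmin⟩ : ∃ k, (∃ p, A p k ≠ C p k) ∧ ∀ q < k, ¬∃ p, A p q ≠ C p q :=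
    ⟨Nat.find hne, Nat.find_spec hne, fun q hq => Nat.find_min hne hq⟩
  have hk : ∀ q < k, ∀ p, A p q = C p q := fun q hq p => not_not.1 fun h => hkmin q hq ⟨p, h⟩
  obtain ⟨a, ha, hamin⟩ : ∃ a, A a k ≠ C a k ∧ ∀ p < a, ¬(A p k ≠ C p k) :=
    ⟨Nat.find hdiff, Nat.find_spec hdiff, fun q hq => Nat.find_min hdiff hq⟩
  have hcorner : 0 ≤ A a k - C a k := by
    have h := leadingSum_sub_leadingSum (X := fun p q => A p q - C p q) (k := k)
      (fun q hq p => by simp [hk q hq p]) (Nat.zero_le (a + 1)) (Nat.le_add_right k 1)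
    rw [leadingSum_sub, leadingSum_sub, Nat.Ico_succ_singleton, sum_singleton,
      Nat.Ico_zero_eq_range, sum_range_succ,
      sum_eq_zero fun p hp => sub_eq_zero.2 (not_not.1 (hamin p (mem_range.1 hp)))] at h
    simp only [leadingSum, range_zero, sum_empty] at h
    have := hT (a + 1) (k + 1)
    simp only [leadingSum] at this
    omega
  have hAa : A a k = 1 := by
    rcases hA01 a k with h | h <;> rcases hC01 a k with h' | h' <;> omega
  have hCa : C a k = 0 := by
    rcases hC01 a k with h' | h' <;> omega
  have ham : a < m := by
    by_contra h
    have := hm a k (by omega)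
    omega
  have hex : ∃ e, a < e ∧ C e k = 1 := by
    by_contra! h
    have : ∑ p ∈ range m, C p k < ∑ p ∈ range m, A p k := by
      refine sum_lt_sum (fun p _ => ?_) ⟨a, mem_range.2 ham, by omega⟩
      rcases lt_trichotomy p a with hp | rfl | hp
      · exact (not_not.1 (hamin p hp)).ge
      · omega
      · rw [(hC01 p k).resolve_right (h p hp)]
        rcases hA01 p k with h | h <;> omega
    exact this.ne' (hcol k)
  obtain ⟨e, ⟨hae, hCe⟩, hemin⟩ : ∃ e, (a < e ∧ C e k = 1) ∧ ∀ p < e, ¬(a < p ∧ C p k = 1) :=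
    ⟨Nat.find hex, Nat.find_spec hex, fun q hq => Nat.find_min hex hq⟩
  have hC (p : ℕ) (hap : a ≤ p) (hpe : p < e) : C p k = 0 := by
    rcases hap.eq_or_lt with rfl | hap
    · exact hCa
    · exact (hC01 p k).resolve_right fun h => hemin p hpe ⟨hap, h⟩
  by_cases hA : ∀ p, a < p → p ≤ e → A p k = 0
  · exact canLower_or_canRaise_of_gap hA01 hC01 hA2 hC2 hT hn hk hae hAa hCe hA hC
  push Not at hA
  obtain ⟨b, hab, hbe, hb⟩ := hA
  have hAb : A b k = 1 := (hA01 b k).resolve_left hb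
  have hbm : b < m := by
    by_contra h
    exact hb (hm b k (by omega))
  obtain ⟨d, hde, hCd⟩ : ∃ d, d ≠ e ∧ C d k = 1 := by
    by_contra! h
    have hC1 : ∑ p ∈ range m, C p k ≤ 1 := by
      calc ∑ p ∈ range m, C p k ≤ ∑ p ∈ range m, if p = e then 1 else 0 := by
            refine sum_le_sum fun p _ => ?_
            split_ifs with hp
            · rcases hC01 p k with h | h <;> omega
            · exact ((hC01 p k).resolve_right (h p hp)).le
        _ ≤ 1 := by rw [sum_ite_eq']; split_ifs <;> norm_num
    have hA2' : ∑ p ∈ {a, b}, A p k ≤ ∑ p ∈ range m, A p k := by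
      refine sum_le_sum_of_subset_of_nonneg ?_ fun p _ _ => ?_
      · intro p
        simp only [mem_insert, mem_singleton, mem_range]
        omega
      · rcases hA01 p k with h | h <;> omega
    rw [sum_pair hab.ne, hcol k] at hA2'
    omega
  have hed : e < d := by
    by_contra hle
    rcases lt_or_ge d a with hda | had
    · exact not_three_of_sum_le_two (hA2 k) hda hab
        ((not_not.1 (hamin d hda)).trans hCd) hAa hAb
    · have := hC d had (by omega)
      omega
  exact canLower_or_canRaise_of_pairs hA01 hC01 hA2 hC2 hT hn hk hab hbe hed hAa hAb hCe hCd

end Core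

section Fin

variable {m n : ℕ}

/-- The integer matrix indexed by `ℕ × ℕ` that extends `M` by zero. -/
def extendByZero (M : Fin m → Fin n → ℕ) (p q : ℕ) : ℤ :=
  if h : p < m ∧ q < n then M ⟨p, h.1⟩ ⟨q, h.2⟩ else 0

@[simp]
lemma extendByZero_val (M : Fin m → Fin n → ℕ) (p : Fin m) (q : Fin n) :
    extendByZero M p q = M p q := by
  simp [extendByZero]

lemma extendByZero_of_le_left (M : Fin m → Fin n → ℕ) {p : ℕ} (q : ℕ) (hp : m ≤ p) :
    extendByZero M p q = 0 :=
  dif_neg fun h => by omega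

lemma extendByZero_of_le_right (M : Fin m → Fin n → ℕ) (p : ℕ) {q : ℕ} (hq : n ≤ q) :
    extendByZero M p q = 0 :=
  dif_neg fun h => by omega

lemma extendByZero_eq_one {M : Fin m → Fin n → ℕ} {p q : ℕ} (h : extendByZero M p q = 1) :
    p < m ∧ q < n := by
  by_contra h'
  simp [extendByZero, h'] at h

lemma sum_filter_le_eq_sum_range {N : ℕ} (f : ℕ → ℤ) (i : Fin N) :
    ∑ p ∈ univ.filter (fun p : Fin N => p ≤ i), f p = ∑ p ∈ range (i + 1), f p := by
  refine sum_bij (fun p _ => p) (fun p hp => ?_) (fun p _ q _ h => Fin.ext h)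
    (fun p hp => ?_) fun p _ => rfl
  · simp only [mem_filter, mem_univ, true_and, Fin.le_def] at hp
    exact mem_range.2 (by omega)
  · rw [mem_range] at hp
    exact ⟨⟨p, by omega⟩, by simp only [mem_filter, mem_univ, true_and, Fin.le_def]; omega, rfl⟩

lemma sigmaM_eq_leadingSum (M : Fin m → Fin n → ℕ) (i : Fin m) (j : Fin n) :
    (sigmaM M i j : ℤ) = leadingSum (extendByZero M) (i + 1) (j + 1) := by
  rw [leadingSum, ← sum_filter_le_eq_sum_range (fun p => ∑ q ∈ range (j + 1), _) i, sigmaM]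
  push_cast
  refine sum_congr rfl fun p _ => ?_
  rw [← sum_filter_le_eq_sum_range _ j]
  simp

lemma sum_range_eq_sum_range_min {f : ℕ → ℤ} {N : ℕ} (hf : ∀ p, N ≤ p → f p = 0) (i : ℕ) :
    ∑ p ∈ range i, f p = ∑ p ∈ range (min i N), f p := by
  refine (sum_subset (range_mono (min_le_left _ _)) fun p hp hp' => hf p ?_).symm
  rw [mem_range] at hp hp'
  omega

lemma leadingSum_extendByZero_eq_min (M : Fin m → Fin n → ℕ) (i j : ℕ) :
    leadingSum (extendByZero M) i j = leadingSum (extendByZero M) (min i m) (min j n) := by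
  rw [leadingSum, leadingSum, sum_range_eq_sum_range_min (N := m) fun p hp =>
    sum_eq_zero fun q _ => extendByZero_of_le_left M q hp]
  exact sum_congr rfl fun p _ =>
    sum_range_eq_sum_range_min (fun q hq => extendByZero_of_le_right M p hq) j

lemma bruhatLE.leadingSum_le {M₁ M₂ : Fin m → Fin n → ℕ} (h : bruhatLE M₁ M₂) (i j : ℕ) :
    leadingSum (extendByZero M₂) i j ≤ leadingSum (extendByZero M₁) i j := by
  rw [leadingSum_extendByZero_eq_min M₁, leadingSum_extendByZero_eq_min M₂]
  rcases hi : min i m with _ | i'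
  · simp [leadingSum]
  rcases hj : min j n with _ | j'
  · simp [leadingSum]
  have := h ⟨i', by omega⟩ ⟨j', by omega⟩
  zify at this
  simpa [sigmaM_eq_leadingSum] using this

variable {r : Fin m → ℕ} {c : Fin n → ℕ} {M M' M₁ M₂ : Fin m → Fin n → ℕ}

lemma isBCT.extendByZero_eq (h : isBCT r c M) (p q : ℕ) :
    extendByZero M p q = 0 ∨ extendByZero M p q = 1 := by
  by_cases hpq : p < m ∧ q < n
  · rcases h.1 ⟨p, hpq.1⟩ ⟨q, hpq.2⟩ with h | h <;> simp [extendByZero, hpq, h]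
  · simp [extendByZero, hpq]

lemma isBCT.sum_col (h : isBCT r c M) (q : ℕ) :
    ∑ p ∈ range m, extendByZero M p q = if hq : q < n then (c ⟨q, hq⟩ : ℤ) else 0 := by
  split_ifs with hq
  · rw [← h.2.2 ⟨q, hq⟩, ← Fin.sum_univ_eq_sum_range (fun p => extendByZero M p q)]
    push_cast
    exact sum_congr rfl fun p _ => extendByZero_val M p ⟨q, hq⟩
  · exact sum_eq_zero fun p _ => extendByZero_of_le_right M p (by omega)

lemma isBCT.sum_row (h : isBCT r c M) (p : ℕ) :
    ∑ q ∈ range n, extendByZero M p q = if hp : p < m then (r ⟨p, hp⟩ : ℤ) else 0 := by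
  split_ifs with hp
  · rw [← h.2.1 ⟨p, hp⟩, ← Fin.sum_univ_eq_sum_range (fun q => extendByZero M p q)]
    push_cast
    exact sum_congr rfl fun q _ => extendByZero_val M ⟨p, hp⟩ q
  · exact sum_eq_zero fun q _ => extendByZero_of_le_left M q (by omega)

lemma isBCT.sum_le_two (h : isBCT r c M) (hc : ∀ j, c j ≤ 2) (q : ℕ) (s : Finset ℕ) :
    ∑ p ∈ s, extendByZero M p q ≤ 2 := by
  calc ∑ p ∈ s, extendByZero M p q ≤ ∑ p ∈ s ∪ range m, extendByZero M p q :=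
        sum_le_sum_of_subset_of_nonneg subset_union_left fun p _ _ => by
          rcases h.extendByZero_eq p q with h | h <;> omega
    _ = ∑ p ∈ range m, extendByZero M p q :=
        (sum_subset subset_union_right fun p _ hp => extendByZero_of_le_left M q (by
          rw [mem_range] at hp; omega)).symm
    _ ≤ 2 := by
        rw [h.sum_col]
        split_ifs with hq
        · exact_mod_cast hc _
        · norm_num

lemma isBCT.leadingSum_eq (h₁ : isBCT r c M₁) (h₂ : isBCT r c M₂) (i j : ℕ) (hj : n ≤ j) :
    leadingSum (extendByZero M₁) i j = leadingSum (extendByZero M₂) i j := by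
  rw [leadingSum_extendByZero_eq_min M₁, leadingSum_extendByZero_eq_min M₂, min_eq_right hj]
  exact sum_congr rfl fun p _ => by rw [h₁.sum_row, h₂.sum_row]

/-- `M'` is obtained from `M` by an `L2 → I2` interchange at rows `i < j` and columns `k < l`. -/
def InterchangeAt (M M' : Fin m → Fin n → ℕ) (i j : Fin m) (k l : Fin n) : Prop :=
  i < j ∧ k < l ∧
    M i k = 0 ∧ M i l = 1 ∧ M j k = 1 ∧ M j l = 0 ∧
    M' i k = 1 ∧ M' i l = 0 ∧ M' j k = 0 ∧ M' j l = 1 ∧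
    (∀ p q, ¬((p = i ∨ p = j) ∧ (q = k ∨ q = l)) → M' p q = M p q)

lemma interchangeStep_iff : InterchangeStep M M' ↔ ∃ i j k l, InterchangeAt M M' i j k l :=
  Iff.rfl

section InterchangeAt

variable {i j : Fin m} {k l : Fin n}

lemma InterchangeAt.entry (h : InterchangeAt M M' i j k l) (p : Fin m) (q : Fin n) :
    (M' p q : ℤ) = M p q + ((if p = i then 1 else 0) - if p = j then 1 else 0) *
      ((if q = k then 1 else 0) - if q = l then 1 else 0) := by
  obtain ⟨hij, hkl, h₁, h₂, h₃, h₄, h₁', h₂', h₃', h₄', h⟩ := h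
  by_cases hpq : (p = i ∨ p = j) ∧ (q = k ∨ q = l)
  · obtain ⟨rfl | rfl, rfl | rfl⟩ := hpq <;>
      simp [*, hij.ne, hij.ne', hkl.ne, hkl.ne']
  · rw [h p q hpq]
    by_cases hp : p = i ∨ p = j
    · have hq : q ≠ k ∧ q ≠ l := by tauto
      simp [hq]
    · have hp : p ≠ i ∧ p ≠ j := by tauto
      simp [hp]

lemma InterchangeAt.sigmaM_eq (h : InterchangeAt M M' i j k l) (p : Fin m) (q : Fin n) :
    sigmaM M' p q = sigmaM M p q + if (i ≤ p ∧ p < j) ∧ k ≤ q ∧ q < l then 1 else 0 := by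
  have hij := h.1
  have hkl := h.2.1
  have hsum : (sigmaM M' p q : ℤ) = sigmaM M p q +
      ((if i ≤ p then 1 else 0) - if j ≤ p then 1 else 0) *
        ((if k ≤ q then 1 else 0) - if l ≤ q then 1 else 0) := by
    simp only [sigmaM, Nat.cast_sum, h.entry, sum_add_distrib, ← mul_sum, ← sum_mul,
      sum_sub_distrib, sum_ite_eq', mem_filter, mem_univ, true_and]
  split_ifs at hsum ⊢ <;> omega

lemma InterchangeAt.bruhatLE (h : InterchangeAt M M' i j k l) : bruhatLE M' M :=
  fun p q => by simp [h.sigmaM_eq]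

lemma InterchangeAt.sum_sigmaM_lt (h : InterchangeAt M M' i j k l) :
    ∑ p, ∑ q, sigmaM M p q < ∑ p, ∑ q, sigmaM M' p q :=
  sum_lt_sum (fun p _ => sum_le_sum fun q _ => h.bruhatLE p q) ⟨i, mem_univ _,
    sum_lt_sum (fun q _ => h.bruhatLE i q) ⟨k, mem_univ _, by simp [h.sigmaM_eq, h.1, h.2.1]⟩⟩

lemma InterchangeAt.isBCT_iff (h : InterchangeAt M M' i j k l) :
    isBCT r c M ↔ isBCT r c M' := by
  have hrow (p : Fin m) : ∑ q, M' p q = ∑ q, M p q := by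
    zify
    simp [h.entry, sum_add_distrib, ← mul_sum]
  have hcol (q : Fin n) : ∑ p, M' p q = ∑ p, M p q := by
    zify
    simp [h.entry, sum_add_distrib, ← sum_mul]
  have h01 (p : Fin m) (q : Fin n) : (M p q = 0 ∨ M p q = 1) ↔ (M' p q = 0 ∨ M' p q = 1) := by
    obtain ⟨hij, hkl, h₁, h₂, h₃, h₄, h₁', h₂', h₃', h₄', h⟩ := h
    by_cases hpq : (p = i ∨ p = j) ∧ (q = k ∨ q = l)
    · obtain ⟨rfl | rfl, rfl | rfl⟩ := hpq <;> simp [*]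
    · rw [h p q hpq]
  simp only [isBCT, hrow, hcol, h01]

/-- Overwrite the entries `(i, k), (j, l)` of `M` by `x` and `(i, l), (j, k)` by `y`. -/
def overwrite (M : Fin m → Fin n → ℕ) (i j : Fin m) (k l : Fin n) (x y : ℕ)
    (p : Fin m) (q : Fin n) : ℕ :=
  if p = i ∧ q = k ∨ p = j ∧ q = l then x
  else if p = i ∧ q = l ∨ p = j ∧ q = k then y else M p q

lemma overwrite_of_not {x y : ℕ} {p : Fin m} {q : Fin n}
    (h : ¬((p = i ∨ p = j) ∧ (q = k ∨ q = l))) : overwrite M i j k l x y p q = M p q := by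
  rw [overwrite, if_neg (by tauto), if_neg (by tauto)]

lemma interchangeAt_overwrite_right (hij : i < j) (hkl : k < l)
    (hik : M i k = 0) (hil : M i l = 1) (hjk : M j k = 1) (hjl : M j l = 0) :
    InterchangeAt M (overwrite M i j k l 1 0) i j k l :=
  ⟨hij, hkl, hik, hil, hjk, hjl, by simp [overwrite],
    by simp [overwrite, hij.ne, hkl.ne'], by simp [overwrite, hij.ne', hkl.ne],
    by simp [overwrite], fun _ _ => overwrite_of_not⟩

lemma interchangeAt_overwrite_left (hij : i < j) (hkl : k < l)
    (hik : M i k = 1) (hil : M i l = 0) (hjk : M j k = 0) (hjl : M j l = 1) :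
    InterchangeAt (overwrite M i j k l 0 1) M i j k l :=
  ⟨hij, hkl, by simp [overwrite],
    by simp [overwrite, hij.ne, hkl.ne'], by simp [overwrite, hij.ne', hkl.ne],
    by simp [overwrite], hik, hil, hjk, hjl, fun _ _ h => (overwrite_of_not h).symm⟩

lemma ExceedsOn.sigmaM_lt (h : ExceedsOn (extendByZero M₁) (extendByZero M₂) i j k l)
    {p : Fin m} {q : Fin n} (hpq : (i ≤ p ∧ p < j) ∧ k ≤ q ∧ q < l) :
    sigmaM M₂ p q < sigmaM M₁ p q := by
  zify
  rw [sigmaM_eq_leadingSum, sigmaM_eq_leadingSum]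
  exact h p q hpq.1.1 hpq.1.2 hpq.2.1 hpq.2.2

end InterchangeAt

lemma exists_step_of_canLower (hle : bruhatLE M₁ M₂)
    (h : CanLower (extendByZero M₁) (extendByZero M₂)) :
    ∃ M, InterchangeStep M₂ M ∧ bruhatLE M₁ M := by
  obtain ⟨i, j, k, l, hij, hkl, hex, hik, hil, hjk, hjl⟩ := h
  obtain ⟨hi, hl⟩ := extendByZero_eq_one hil
  obtain ⟨hj, hk⟩ := extendByZero_eq_one hjk
  lift i to Fin m using hi
  lift j to Fin m using hj
  lift k to Fin n using hk
  lift l to Fin n using hl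
  rw [extendByZero_val] at hik hil hjk hjl
  norm_cast at hik hil hjk hjl hij hkl
  have hstep := interchangeAt_overwrite_right hij hkl hik hil hjk hjl
  refine ⟨_, ⟨i, j, k, l, hstep⟩, fun p q => ?_⟩
  rw [hstep.sigmaM_eq]
  split_ifs with hpq
  · exact hex.sigmaM_lt hpq
  · exact hle p q

lemma exists_step_of_canRaise (hle : bruhatLE M₁ M₂)
    (h : CanRaise (extendByZero M₁) (extendByZero M₂)) :
    ∃ M, InterchangeStep M M₁ ∧ bruhatLE M M₂ := by
  obtain ⟨i, j, k, l, hij, hkl, hex, hik, hil, hjk, hjl⟩ := h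
  obtain ⟨hi, hk⟩ := extendByZero_eq_one hik
  obtain ⟨hj, hl⟩ := extendByZero_eq_one hjl
  lift i to Fin m using hi
  lift j to Fin m using hj
  lift k to Fin n using hk
  lift l to Fin n using hl
  rw [extendByZero_val] at hik hil hjk hjl
  norm_cast at hik hil hjk hjl hij hkl
  have hstep := interchangeAt_overwrite_left hij hkl hik hil hjk hjl
  refine ⟨_, ⟨i, j, k, l, hstep⟩, fun p q => ?_⟩
  have hsigma := hstep.sigmaM_eq p q
  split_ifs at hsigma with hpq
  · have := hex.sigmaM_lt hpq
    omega
  · have := hle p q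
    omega

lemma bruhatLE_of_secBLE (h : secBLE M₁ M₂) : bruhatLE M₁ M₂ := by
  induction h with
  | refl => exact fun _ _ => le_rfl
  | tail _ hstep ih =>
    obtain ⟨i, j, k, l, hat⟩ := interchangeStep_iff.1 hstep
    exact fun p q => (ih p q).trans (hat.bruhatLE p q)

lemma exists_step_of_bruhatLE (hc : ∀ j, c j ≤ 2) (h₁ : isBCT r c M₁) (h₂ : isBCT r c M₂)
    (hle : bruhatLE M₁ M₂) (hne : M₁ ≠ M₂) :
    (∃ M, InterchangeStep M₂ M ∧ bruhatLE M₁ M) ∨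
      ∃ M, InterchangeStep M M₁ ∧ bruhatLE M M₂ := by
  have hdiff : ∃ q p, extendByZero M₁ p q ≠ extendByZero M₂ p q := by
    by_contra! h
    exact hne (funext₂ fun p q => by simpa using h q p)
  refine (canLower_or_canRaise (m := m) (n := n) h₁.extendByZero_eq h₂.extendByZero_eq
    (h₁.sum_le_two hc) (h₂.sum_le_two hc) (fun q => by rw [h₁.sum_col, h₂.sum_col])
    (fun p q hp => extendByZero_of_le_left M₁ q hp) hle.leadingSum_le
    (fun i j hj => h₂.leadingSum_eq h₁ i j hj) hdiff).imp
    (exists_step_of_canLower hle) (exists_step_of_canRaise hle)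

lemma secBLE_of_bruhatLE (hc : ∀ j, c j ≤ 2) (h₁ : isBCT r c M₁) (h₂ : isBCT r c M₂)
    (hle : bruhatLE M₁ M₂) : secBLE M₁ M₂ := by
  induction hN : ∑ p, ∑ q, sigmaM M₁ p q - ∑ p, ∑ q, sigmaM M₂ p q using Nat.strong_induction_on
    generalizing M₁ M₂ with
  | _ N ih =>
  by_cases hne : M₁ = M₂
  · exact hne ▸ Relation.ReflTransGen.refl
  have hsum {M M' : Fin m → Fin n → ℕ} (h : bruhatLE M M') :
      ∑ p, ∑ q, sigmaM M' p q ≤ ∑ p, ∑ q, sigmaM M p q :=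
    sum_le_sum fun p _ => sum_le_sum fun q _ => h p q
  rcases exists_step_of_bruhatLE hc h₁ h₂ hle hne with ⟨M, hstep, hM⟩ | ⟨M, hstep, hM⟩ <;>
    obtain ⟨i, j, k, l, hat⟩ := interchangeStep_iff.1 hstep <;>
    have hlt := hat.sum_sigmaM_lt <;>
    have hle' := hsum hM
  · exact (ih _ (by omega) h₁ (hat.isBCT_iff.1 h₂) hM rfl).head hstep
  · exact (ih _ (by omega) (hat.isBCT_iff.2 h₁) h₂ hM rfl).tail hstep

lemma bruhatLE_iff_secBLE_of_col_le_two (hc : ∀ j, c j ≤ 2) (h₁ : isBCT r c M₁)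
    (h₂ : isBCT r c M₂) : bruhatLE M₁ M₂ ↔ secBLE M₁ M₂ :=
  ⟨secBLE_of_bruhatLE hc h₁ h₂, bruhatLE_of_secBLE⟩

lemma isBCT.flip (h : isBCT r c M) : isBCT c r (flip M) :=
  ⟨fun i j => h.1 j i, h.2.2, h.2.1⟩

lemma bruhatLE_flip_iff : bruhatLE (flip M₁) (flip M₂) ↔ bruhatLE M₁ M₂ := by
  have h (M : Fin m → Fin n → ℕ) (i : Fin m) (j : Fin n) :
      sigmaM (flip M) j i = sigmaM M i j := sum_comm
  simp only [bruhatLE, h]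
  exact forall_comm

lemma InterchangeStep.flip (h : InterchangeStep M M') :
    InterchangeStep (flip M) (flip M') := by
  obtain ⟨i, j, k, l, hij, hkl, h₁, h₂, h₃, h₄, h₁', h₂', h₃', h₄', h⟩ := h
  exact ⟨k, l, i, j, hkl, hij, h₁, h₃, h₂, h₄, h₁', h₃', h₂', h₄',
    fun p q hpq => h q p fun hqp => hpq hqp.symm⟩

lemma secBLE.flip (h : secBLE M₁ M₂) : secBLE (flip M₁) (flip M₂) :=
  h.lift (p := InterchangeStep) (_root_.flip) fun _ _ hstep => InterchangeStep.flip hstep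

end Fin

/-- If `c = (1,...,1)` or `c = (2,...,2)` (or symmetrically `r = (1,...,1)` or
`r = (2,...,2)`), the combinatorial Bruhat order and the combinatorial secondary Bruhat
order coincide on `BCT(r,c)`. -/
theorem bruhat_orders_coincide_one_two {m n : ℕ} (r : Fin m → ℕ) (c : Fin n → ℕ)
    (hsum : ∑ i, r i = ∑ j, c j)
    (h : (∀ j, c j = 1) ∨ (∀ j, c j = 2) ∨ (∀ i, r i = 1) ∨ (∀ i, r i = 2)) :
    ∀ M1 M2 : Fin m → Fin n → ℕ, isBCT r c M1 → isBCT r c M2 →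
      (bruhatLE M1 M2 ↔ secBLE M1 M2) := by
  intro M₁ M₂ h₁ h₂
  have hle : (∀ j, c j ≤ 2) ∨ ∀ i, r i ≤ 2 := by
    rcases h with h | h | h | h <;> simp [h]
  rcases hle with hc | hr
  · exact bruhatLE_iff_secBLE_of_col_le_two hc h₁ h₂
  · rw [← bruhatLE_flip_iff, bruhatLE_iff_secBLE_of_col_le_two hr h₁.flip h₂.flip]
    exact ⟨secBLE.flip, secBLE.flip⟩
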